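/- arXiv:1210.2568 — 2 statements merged into one kernel-verified Lean document; each statement's English description precedes it below -/
import Mathlib

section
/- Let m = 2^ℓ·n ≥ 3 with n odd, ℓ ≥ 0, n ≥ 1, and let D_m be the dihedral group of order 2m. Then P(D_m), viewed as a set of maps D_m → D_m, equals the disjoint union C(0,1) ∪ ⋃_{i=1}^{t} C((−2)^i, (−2)^{i−1}), where t = ord_m(−2) if ℓ = 0 and n > 1; t = ℓ + per_m(−2) − 1 if ℓ > 0 and n > 1; and t = ℓ − 1 if ℓ > 0 and n = 1. All containers appearing in the union are pairwise disjoint. -/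
open DihedralGroup

/-- The commutator `[g,h] = g⁻¹ h⁻¹ g h`. -/
def gcomm {G : Type*} [Group G] (g h : G) : G := g⁻¹ * h⁻¹ * g * h

/-- The right commutation map `ρ(g) : x ↦ [x,g]`. -/
def rmap {G : Type*} [Group G] (g : G) : G → G := fun x => gcomm x g

/-- The left commutation map `λ(g) : x ↦ [g,x]`. -/
def lmap {G : Type*} [Group G] (g : G) : G → G := fun x => gcomm g x

/-- The element `a^i b^j` of the dihedral group `D_m`, where `a = r 1`, `b = sr 0`. -/
def elt (m : ℕ) (i : ZMod m) (j : ZMod 2) : DihedralGroup m :=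
  r i * (sr 0 : DihedralGroup m) ^ j.val

/-- The map `μ(A,B)`, sending `a^i b^j` to `a^(A·i·(-1)^j − B·((-1)^j − 1))`.
Note `sr k = a^(-k) b`, so `μ(A,B)` sends `sr k` to `r (A·k + 2·B)`. -/
def mumap (m : ℕ) (A B : ZMod m) : DihedralGroup m → DihedralGroup m
  | .r i => .r (A * i)
  | .sr k => .r (A * k + 2 * B)

/-- The `(A,B)`-container `C(A,B) = { μ(A, x·B) : x ∈ ℤ_m }`. -/
def cont (m : ℕ) (A B : ZMod m) : Set (DihedralGroup m → DihedralGroup m) :=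
  { f | ∃ x : ZMod m, f = mumap m A (x * B) }

/-- The right commutation semigroup `P(D_m)`: the subsemigroup of the semigroup of all
maps `D_m → D_m` under composition generated by the ρ-maps. -/
def Psg (m : ℕ) : Subsemigroup (Function.End (DihedralGroup m)) :=
  Subsemigroup.closure {f : Function.End (DihedralGroup m) | ∃ g : DihedralGroup m, f = rmap g}

/-- The index of `x` in the multiplicative semigroup `ℤ_m`. -/
noncomputable def ind (m : ℕ) (x : ZMod m) : ℕ :=
  sInf {c : ℕ | 0 < c ∧ ∃ k : ℕ, 0 < k ∧ x ^ c = x ^ (c + k)}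

/-- The period of `x` in the multiplicative semigroup `ℤ_m`. -/
noncomputable def per (m : ℕ) (x : ZMod m) : ℕ :=
  sInf {k : ℕ | 0 < k ∧ x ^ ind m x = x ^ (ind m x + k)}

theorem rmap_r (m : ℕ) (c : ZMod m) : rmap (r c : DihedralGroup m) = mumap m 0 c := by
  funext x
  rcases x with i | k <;> simp [rmap, gcomm, mumap]
  ring

theorem rmap_sr (m : ℕ) (c : ZMod m) : rmap (sr c : DihedralGroup m) = mumap m (-2) c := by
  funext x
  rcases x with i | k <;> simp [rmap, gcomm, mumap] <;> ring

theorem mumap_comp (m : ℕ) (A B A' B' : ZMod m) :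
    mumap m A B ∘ mumap m A' B' = mumap m (A * A') (A * B') := by
  funext x
  rcases x with i | k <;> simp [mumap] <;> ring

theorem eq_of_mumap_eq {m : ℕ} {A B A' B' : ZMod m} (h : mumap m A B = mumap m A' B') :
    A = A' := by
  simpa [mumap] using congrFun h (r 1)

theorem disjoint_cont {m : ℕ} {A B A' B' : ZMod m} (h : A ≠ A') :
    Disjoint (cont m A B) (cont m A' B') := by
  rw [Set.disjoint_left]
  rintro f ⟨x, rfl⟩ ⟨y, hy⟩
  exact h (eq_of_mumap_eq hy)

theorem cont_congr {m : ℕ} {A B B' : ZMod m} (h : 2 * B = 2 * B') :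
    cont m A B = cont m A B' := by
  have key (x : ZMod m) : mumap m A (x * B) = mumap m A (x * B') := by
    funext y
    rcases y with i | k
    · simp [mumap]
    · simp only [mumap]
      congr 2
      linear_combination x * h
  simp only [cont, key]

theorem cont_subset_cont_zero {m : ℕ} (B : ZMod m) : cont m 0 B ⊆ cont m 0 1 := by
  rintro f ⟨x, rfl⟩
  exact ⟨x * B, by rw [mul_one]⟩

theorem two_mul_neg_two_pow {m i : ℕ} (hi : 0 < i) :
    2 * (-2 : ZMod m) ^ (i - 1) = -(-2) ^ i := by
  obtain ⟨k, rfl⟩ : ∃ k, i = k + 1 := ⟨i - 1, by omega⟩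
  rw [Nat.add_sub_cancel, pow_succ]
  ring

theorem coe_Psg (m : ℕ) : (Psg m : Set (Function.End (DihedralGroup m))) =
    cont m 0 1 ∪ ⋃ i ∈ Set.Ioi 0, cont m ((-2) ^ i) ((-2) ^ (i - 1)) := by
  have mul_def (f g : Function.End (DihedralGroup m)) : f * g = f ∘ g := rfl
  apply Set.Subset.antisymm
  · intro f hf
    induction hf using Subsemigroup.closure_induction with
    | mem f hf =>
      obtain ⟨g | g, rfl⟩ := hf
      · exact Or.inl ⟨g, by rw [rmap_r, mul_one]⟩
      · refine Or.inr (Set.mem_biUnion (x := 1) (Set.mem_Ioi.2 one_pos) ⟨g, ?_⟩)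
        rw [rmap_sr]
        simp
    | mul f g _ _ hf hg =>
      rw [mul_def]
      rcases hf with ⟨x, rfl⟩ | hf
      · rcases hg with ⟨y, rfl⟩ | hg
        · exact Or.inl ⟨0, by rw [mumap_comp, zero_mul, zero_mul, zero_mul]⟩
        · obtain ⟨j, hj, y, rfl⟩ := Set.mem_iUnion₂.1 hg
          exact Or.inl ⟨0, by rw [mumap_comp, zero_mul, zero_mul, zero_mul]⟩
      · obtain ⟨i, hi, x, rfl⟩ := Set.mem_iUnion₂.1 hf
        rcases hg with ⟨y, rfl⟩ | hg
        · exact Or.inl ⟨(-2) ^ i * y, by rw [mumap_comp, mul_zero, mul_one, mul_one]⟩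
        · obtain ⟨j, hj, y, rfl⟩ := Set.mem_iUnion₂.1 hg
          rw [Set.mem_Ioi] at hi hj
          refine Or.inr (Set.mem_biUnion (x := i + j) (Set.mem_Ioi.2 (by omega)) ⟨y, ?_⟩)
          rw [mumap_comp, ← pow_add, Nat.add_sub_assoc hj, pow_add (-2) i (j - 1),
            mul_left_comm]
  · rintro f (⟨x, rfl⟩ | hf)
    · exact Subsemigroup.subset_closure ⟨r x, by rw [rmap_r, mul_one]⟩
    · obtain ⟨i, hi, x, rfl⟩ := Set.mem_iUnion₂.1 hf
      clear hf
      induction i, hi using Nat.le_induction with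
      | base => exact Subsemigroup.subset_closure ⟨sr x, by rw [rmap_sr]; simp; rfl⟩
      | succ i hi ih =>
        have h : (mumap m (-2) 0 ∘ mumap m ((-2) ^ i) (x * (-2) ^ (i - 1)) :
            Function.End (DihedralGroup m)) ∈ Psg m :=
          (Psg m).mul_mem (show mumap m (-2) 0 ∈ Psg m from
          Subsemigroup.subset_closure ⟨sr 0, (rmap_sr m 0).symm⟩) ih
        rw [mumap_comp, mul_left_comm, ← pow_succ', ← pow_succ',
          Nat.sub_add_cancel hi] at h
        exact h

theorem isCoprime_two_neg_two_pow_sub_one {k : ℕ} (hk : 0 < k) :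
    IsCoprime (2 : ℤ) ((-2) ^ k - 1) := by
  obtain ⟨j, rfl⟩ : ∃ j, k = j + 1 := ⟨k - 1, by omega⟩
  exact ⟨-(-2) ^ j, -1, by rw [pow_succ]; ring⟩

theorem neg_two_pow_eq_iff_dvd {m c k : ℕ} :
    (-2 : ZMod m) ^ c = (-2) ^ (c + k) ↔ (m : ℤ) ∣ (-2) ^ c * ((-2) ^ k - 1) := by
  have h := ZMod.intCast_eq_intCast_iff_dvd_sub ((-2) ^ c) ((-2) ^ (c + k)) m
  push_cast at h
  rw [h, pow_add, mul_sub, mul_one]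

theorem le_of_neg_two_pow_eq {ℓ n c k : ℕ} (hk : 0 < k)
    (h : (-2 : ZMod (2 ^ ℓ * n)) ^ c = (-2) ^ (c + k)) : ℓ ≤ c := by
  rw [neg_two_pow_eq_iff_dvd] at h
  push_cast at h
  have h2 : (2 : ℤ) ^ ℓ ∣ (-2) ^ c :=
    (isCoprime_two_neg_two_pow_sub_one hk).pow_left.dvd_of_dvd_mul_right
      ((Dvd.intro _ rfl).trans h)
  rw [← Int.natAbs_dvd_natAbs, Int.natAbs_pow, Int.natAbs_pow] at h2
  exact (Nat.pow_dvd_pow_iff_le_right (by norm_num)).1 h2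

theorem exists_neg_two_pow_eq (ℓ : ℕ) {n : ℕ} (hn : Odd n) :
    ∃ k, 0 < k ∧ (-2 : ZMod (2 ^ ℓ * n)) ^ ℓ = (-2) ^ (ℓ + k) := by
  refine ⟨n.totient, Nat.totient_pos.2 hn.pos, ?_⟩
  rw [neg_two_pow_eq_iff_dvd]
  push_cast
  apply mul_dvd_mul
  · rw [neg_pow]
    exact Dvd.intro_left _ rfl
  · have hu : IsUnit (-2 : ZMod n) := by
      have := (ZMod.isUnit_iff_coprime 2 n).2 (Nat.coprime_two_left.2 hn)
      simpa using this
    have h := ZMod.pow_totient hu.unit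
    have h' := congrArg Units.val h
    rw [Units.val_pow_eq_pow_val, IsUnit.unit_spec, Units.val_one] at h'
    rw [← ZMod.intCast_zmod_eq_zero_iff_dvd]
    push_cast
    rw [h', sub_self]

theorem neg_two_pow_ne_zero {ℓ n : ℕ} (hn : Odd n) (hn1 : 1 < n) (i : ℕ) :
    (-2 : ZMod (2 ^ ℓ * n)) ^ i ≠ 0 := by
  intro h
  have h1 : ((2 ^ ℓ * n : ℕ) : ℤ) ∣ (-2) ^ i := by
    rw [← ZMod.intCast_zmod_eq_zero_iff_dvd]
    push_cast
    exact h
  rw [← Int.natAbs_dvd_natAbs, Int.natAbs_pow, Int.natAbs_natCast] at h1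
  have h2 : n ∣ 2 ^ i := (Dvd.intro_left _ rfl).trans h1
  have h3 := Nat.Coprime.eq_one_of_dvd (Nat.Coprime.pow_right i (Nat.coprime_two_right.2 hn)) h2
  omega

/-- In a monoid, if the powers of `x` have index `e` and period `p`, then `x ^ 1, …, x ^ (e + p - 1)`
are distinct. -/
theorem pow_injOn_of_index_period {M : Type*} [Monoid M] {x : M} {e p : ℕ}
    (hep : x ^ e = x ^ (e + p))
    (he : ∀ c k, 0 < c → 0 < k → x ^ c = x ^ (c + k) → e ≤ c)
    (hp : ∀ k, 0 < k → x ^ e = x ^ (e + k) → p ≤ k) {i j : ℕ} (hi : 0 < i) (hij : i < j)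
    (hj : j ≤ e + p - 1) : x ^ i ≠ x ^ j := by
  intro h
  obtain ⟨d, rfl⟩ : ∃ d, j = i + d := ⟨j - i, by omega⟩
  have hei := he i d hi (by omega) h
  have hpd : p ≤ d := by
    refine hp d (by omega) ?_
    have h1 : x ^ (e + p) = x ^ (e + p + d) := by
      rw [show e + p = i + (e + p - i) by omega, pow_add, h, ← pow_add]
      congr 1
      omega
    rw [← hep, add_right_comm, pow_add x (e + d), pow_add x e d, mul_assoc, ← pow_add,
      add_comm d p, pow_add, ← mul_assoc, ← pow_add, ← hep, ← pow_add] at h1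
    exact h1
  omega

theorem exists_pow_eq_of_index_period {M : Type*} [Monoid M] {x : M} {e p : ℕ} (he : 0 < e)
    (hp : 0 < p) (hep : x ^ e = x ^ (e + p)) {i : ℕ} (hi : 0 < i) :
    ∃ j ∈ Finset.Icc 1 (e + p - 1), x ^ i = x ^ j := by
  induction i using Nat.strong_induction_on with
  | _ i ih =>
    by_cases h : i ≤ e + p - 1
    · exact ⟨i, Finset.mem_Icc.2 ⟨hi, h⟩, rfl⟩
    · obtain ⟨j, hj, hij⟩ := ih (i - p) (by omega) (by omega)
      refine ⟨j, hj, ?_⟩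
      rw [← hij, show i = e + p + (i - p - e) by omega, pow_add, ← hep, ← pow_add]
      congr 1
      omega

/-- Theorem 12(i): `P(D_m)` is the disjoint union
`C(0,1) ∪ ⋃_{i=1}^{t} C((-2)^i, (-2)^(i-1))`. -/
theorem stmt_8 (ℓ n m t : ℕ) (hm : m = 2 ^ ℓ * n) (hm3 : 3 ≤ m) (hn : Odd n)
    (ht : (ℓ = 0 ∧ 1 < n ∧ t = orderOf (-2 : ZMod m)) ∨
          (0 < ℓ ∧ 1 < n ∧ t = ℓ + per m (-2) - 1) ∨
          (0 < ℓ ∧ n = 1 ∧ t = ℓ - 1)) :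
    (Psg m : Set (Function.End (DihedralGroup m))) =
      cont m 0 1 ∪ ⋃ i ∈ Finset.Icc 1 t, cont m ((-2) ^ i) ((-2) ^ (i - 1)) ∧
    (∀ i ∈ Finset.Icc 1 t, Disjoint (cont m 0 1) (cont m ((-2) ^ i) ((-2) ^ (i - 1)))) ∧
    (∀ i ∈ Finset.Icc 1 t, ∀ j ∈ Finset.Icc 1 t, i ≠ j →
      Disjoint (cont m ((-2) ^ i) ((-2) ^ (i - 1))) (cont m ((-2) ^ j) ((-2) ^ (j - 1)))) := by
  subst hm
  suffices key : (∀ i, 0 < i → (-2 : ZMod (2 ^ ℓ * n)) ^ i = 0 ∨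
        ∃ j ∈ Finset.Icc 1 t, (-2 : ZMod (2 ^ ℓ * n)) ^ i = (-2) ^ j) ∧
      (∀ i ∈ Finset.Icc 1 t, (-2 : ZMod (2 ^ ℓ * n)) ^ i ≠ 0) ∧
      ∀ i j, 0 < i → i < j → j ≤ t → (-2 : ZMod (2 ^ ℓ * n)) ^ i ≠ (-2) ^ j by
    obtain ⟨hcover, hne, hinj⟩ := key
    refine ⟨?_, fun i hi => disjoint_cont (hne i hi).symm, fun i hi j hj hij => disjoint_cont ?_⟩
    · rw [coe_Psg]
      apply Set.Subset.antisymm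
      · refine Set.union_subset Set.subset_union_left (Set.iUnion₂_subset fun i hi => ?_)
        rcases hcover i hi with h | ⟨j, hj, h⟩
        · rw [h]
          exact (cont_subset_cont_zero _).trans Set.subset_union_left
        · have hj' := (Finset.mem_Icc.1 hj).1
          have hB : 2 * (-2 : ZMod (2 ^ ℓ * n)) ^ (i - 1) = 2 * (-2) ^ (j - 1) := by
            rw [two_mul_neg_two_pow hi, two_mul_neg_two_pow hj', h]
          rw [cont_congr hB, h]
          exact (Set.subset_biUnion_of_mem (u := fun j =>
            cont (2 ^ ℓ * n) ((-2) ^ j) ((-2) ^ (j - 1))) hj).trans Set.subset_union_right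
      · refine Set.union_subset_union_right _ (Set.biUnion_mono (fun i hi => ?_) fun i _ => le_rfl)
        exact (Finset.mem_Icc.1 hi).1
    · rw [Finset.mem_Icc] at hi hj
      rcases lt_or_gt_of_ne hij with h | h
      · exact hinj i j hi.1 h hj.2
      · exact (hinj j i hj.1 h hi.2).symm
  obtain ⟨k, hk, hk'⟩ := exists_neg_two_pow_eq ℓ hn
  rcases ht with ⟨rfl, hn1, rfl⟩ | ⟨hl, hn1, rfl⟩ | ⟨hl, rfl, rfl⟩
  · set x : ZMod (2 ^ 0 * n) := -2
    have hx : x ^ k = 1 := by simpa using hk'.symm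
    have hpos : 0 < orderOf x := orderOf_pos_iff.2 (isOfFinOrder_iff_pow_eq_one.2 ⟨k, hk, hx⟩)
    have hep : x ^ 1 = x ^ (1 + orderOf x) := by rw [pow_add, pow_orderOf_eq_one, mul_one]
    have hu : IsUnit x := IsUnit.of_pow_eq_one hx hk.ne'
    have ht : 1 + orderOf x - 1 = orderOf x := by omega
    refine ⟨fun i hi => Or.inr ?_, fun i _ => neg_two_pow_ne_zero hn hn1 i,
      fun i j hi hij hj => ?_⟩
    · simpa only [ht] using exists_pow_eq_of_index_period one_pos hpos hep hi
    · refine pow_injOn_of_index_period hep (fun c _ hc _ _ => hc) (fun d hd h => ?_) hi hij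
        (ht.symm ▸ hj)
      rw [pow_add] at h
      exact orderOf_le_of_pow_eq_one hd ((hu.pow 1).mul_eq_left.1 h.symm)
  · set x : ZMod (2 ^ ℓ * n) := -2 with hxdef
    have hind : ind (2 ^ ℓ * n) x = ℓ := by
      apply le_antisymm
      · exact Nat.sInf_le ⟨hl, k, hk, hk'⟩
      · refine le_csInf ⟨ℓ, hl, k, hk, hk'⟩ ?_
        rintro c ⟨_, d, hd, h⟩
        exact le_of_neg_two_pow_eq hd h
    have hper : 0 < per (2 ^ ℓ * n) x ∧ x ^ ℓ = x ^ (ℓ + per (2 ^ ℓ * n) x) := by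
      have := Nat.sInf_mem (s := {k : ℕ | 0 < k ∧ x ^ ind (2 ^ ℓ * n) x =
        x ^ (ind (2 ^ ℓ * n) x + k)}) ⟨k, hk, by rw [hind]; exact hk'⟩
      rw [Set.mem_ofPred_eq] at this
      simpa only [per, hind] using this
    refine ⟨fun i hi => Or.inr (exists_pow_eq_of_index_period hl hper.1 hper.2 hi),
      fun i _ => neg_two_pow_ne_zero hn hn1 i, fun i j hi hij hj => ?_⟩
    refine pow_injOn_of_index_period hper.2 (fun c d _ hd h => le_of_neg_two_pow_eq hd h)
      (fun d hd h => Nat.sInf_le ⟨hd, ?_⟩) hi hij hj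
    rw [hind]
    exact h
  · have hzero : (-2 : ZMod (2 ^ ℓ * 1)) ^ ℓ = 0 := by
      have h := ZMod.natCast_self (2 ^ ℓ * 1)
      push_cast at h
      rw [neg_pow, (mul_one _).symm.trans h, mul_zero]
    refine ⟨fun i hi => ?_, fun i hi h => ?_, fun i j hi hij hj h => ?_⟩
    · by_cases h : i ≤ ℓ - 1
      · exact Or.inr ⟨i, Finset.mem_Icc.2 ⟨hi, h⟩, rfl⟩
      · exact Or.inl (pow_eq_zero_of_le (by omega) hzero)
    · rw [Finset.mem_Icc] at hi
      have := le_of_neg_two_pow_eq (ℓ := ℓ) (n := 1) (c := i) (k := 1) one_pos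
        (by rw [pow_succ, h, zero_mul])
      omega
    · obtain ⟨d, rfl⟩ : ∃ d, j = i + d := ⟨j - i, by omega⟩
      have := le_of_neg_two_pow_eq (by omega) h
      omega
end

section
/- Let m = 2^ℓ·n > 3 with n odd. Then: (i) |P(D_m)| = m/|Z_1| + Σ_{i=1}^{t−1} m/|Z_i|, where t = 1 + ord_m(−2) if ℓ = 0 and n > 1; t = ℓ + per_m(−2) if ℓ > 0 and n > 1; and t = ℓ if ℓ > 0 and n = 1. (ii) |Λ(D_m)| = m/|Z_1| + Σ_{i=1}^{t'−1} m/|Z_i|, where t' = 1 + ord_m(2) if ℓ = 0 and n > 1; t' = ℓ + per_m(2) if ℓ > 0 and n > 1; and t' = ℓ if ℓ > 0 and n = 1. Here Z_i denotes the i-th term of the upper central series of D_m, and each |Z_i| divides m. -/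
open DihedralGroup

/-- The left commutation semigroup `Λ(D_m)`. -/
def Lsg (m : ℕ) : Subsemigroup (Function.End (DihedralGroup m)) :=
  Subsemigroup.closure {f : Function.End (DihedralGroup m) | ∃ g : DihedralGroup m, f = lmap g}

/-! ### The upper central series of a dihedral group -/

lemma gcomm_r_r {m : ℕ} (i j : ZMod m) :
    gcomm (r i : DihedralGroup m) (r j) = r 0 := by
  simp [gcomm]

lemma gcomm_r_sr {m : ℕ} (i k : ZMod m) :
    gcomm (r i : DihedralGroup m) (sr k) = r (-(2 * i)) := by
  simp only [gcomm, inv_r, inv_sr, r_mul_sr, sr_mul_r, sr_mul_sr, r.injEq]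
  ring

lemma gcomm_sr_r {m : ℕ} (k i : ZMod m) :
    gcomm (sr k : DihedralGroup m) (r i) = r (2 * i) := by
  simp only [gcomm, inv_r, inv_sr, sr_mul_r, sr_mul_sr, r_mul_r, r.injEq]
  ring

lemma gcomm_sr_sr {m : ℕ} (k l : ZMod m) :
    gcomm (sr k : DihedralGroup m) (sr l) = r (2 * (l - k)) := by
  simp only [gcomm, inv_sr, r_mul_sr, sr_mul_sr, r.injEq]
  ring

lemma mem_upperCentralSeries_succ_iff_gcomm {G : Type*} [Group G] {i : ℕ} {g : G} :
    g ∈ Subgroup.upperCentralSeries G (i + 1) ↔ ∀ h, gcomm g h ∈ Subgroup.upperCentralSeries G i := by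
  rw [← inv_mem_iff, Subgroup.mem_upperCentralSeries_succ_iff, ← (Equiv.inv G).forall_congr_right]
  simp only [Equiv.inv_apply, commutatorElement_def, inv_inv, gcomm]

lemma mem_upperCentralSeries_dihedral {m i : ℕ} (hi : (2 : ZMod m) ^ i ≠ 0)
    (g : DihedralGroup m) :
    g ∈ Subgroup.upperCentralSeries (DihedralGroup m) i ↔ ∃ x : ZMod m, g = r x ∧ 2 ^ i * x = 0 := by
  induction i generalizing g with
  | zero =>
    rw [Subgroup.upperCentralSeries_zero, Subgroup.mem_bot]
    simp only [pow_zero, one_mul, exists_eq_right]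
    rfl
  | succ i ih =>
    have hi' : (2 : ZMod m) ^ i ≠ 0 := fun h => hi (by rw [pow_succ, h, zero_mul])
    rw [mem_upperCentralSeries_succ_iff_gcomm]
    simp only [ih hi']
    cases g with
    | r x =>
      simp only [r.injEq, exists_eq_left', pow_succ]
      refine ⟨fun H => ?_, fun H h => ?_⟩
      · obtain ⟨y, hy, hy'⟩ := H (sr 0)
        rw [gcomm_r_sr, r.injEq] at hy
        subst hy
        linear_combination -hy'
      · cases h with
        | r j => exact ⟨0, gcomm_r_r _ _, mul_zero _⟩
        | sr k => exact ⟨_, gcomm_r_sr _ _, by linear_combination -H⟩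
    | sr k =>
      refine ⟨fun H => ?_, fun ⟨x, hx, _⟩ => by simp at hx⟩
      obtain ⟨y, hy, hy'⟩ := H (r 1)
      rw [gcomm_sr_r, r.injEq] at hy
      subst hy
      exact absurd (by linear_combination hy') hi

lemma pow_eq_zero_iff_two_pow {R : Type*} [Ring R] {s : R} (hs : s = 2 ∨ s = -2) (i : ℕ) :
    s ^ i = 0 ↔ (2 : R) ^ i = 0 := by
  rcases hs with rfl | rfl
  · rfl
  · rw [neg_pow]
    rcases neg_one_pow_eq_or R i with h | h <;> simp [h]

lemma card_upperCentralSeries_mul_card_image {m i : ℕ} [NeZero m]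
    (hi : (2 : ZMod m) ^ i ≠ 0) {s : ZMod m} (hs : s = 2 ∨ s = -2) :
    Nat.card (Subgroup.upperCentralSeries (DihedralGroup m) i) *
      (Finset.univ.image (s ^ i * ·)).card = m := by
  set f := AddMonoidHom.mulLeft (s ^ i) with hf
  have hker : ∀ x : ZMod m, x ∈ f.ker ↔ 2 ^ i * x = 0 := by
    intro x
    rw [AddMonoidHom.mem_ker, hf, AddMonoidHom.coe_mulLeft]
    rcases hs with rfl | rfl
    · rfl
    · rw [neg_pow, mul_assoc]
      rcases neg_one_pow_eq_or (ZMod m) i with h | h <;> simp [h]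
  have h1 : Nat.card (Subgroup.upperCentralSeries (DihedralGroup m) i) = Nat.card f.ker := by
    refine (Nat.card_congr (Equiv.ofBijective
      (fun x : f.ker => (⟨r x.1, (mem_upperCentralSeries_dihedral hi _).2
        ⟨x.1, rfl, (hker _).1 x.2⟩⟩ : Subgroup.upperCentralSeries (DihedralGroup m) i)) ⟨?_, ?_⟩)).symm
    · intro x y h
      exact Subtype.ext (r.inj (congrArg Subtype.val h))
    · rintro ⟨g, hg⟩
      obtain ⟨x, rfl, hx⟩ := (mem_upperCentralSeries_dihedral hi _).1 hg
      exact ⟨⟨x, (hker x).2 hx⟩, rfl⟩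
  have h2 : (Finset.univ.image (s ^ i * ·)).card = Nat.card f.range := by
    rw [← SetLike.coe_sort_coe, Nat.card_coe_set_eq, AddMonoidHom.coe_range,
      ← Set.ncard_coe_finset]
    simp [hf]
  rw [h1, h2, ← AddSubgroup.index_ker, AddSubgroup.card_mul_index, Nat.card_zmod]

lemma card_upperCentralSeries_dvd {m i : ℕ} [NeZero m] (hi : (2 : ZMod m) ^ i ≠ 0) :
    Nat.card (Subgroup.upperCentralSeries (DihedralGroup m) i) ∣ m :=
  ⟨_, (card_upperCentralSeries_mul_card_image hi (.inl rfl)).symm⟩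

lemma card_image_pow_mul {m i : ℕ} [NeZero m] (hi : (2 : ZMod m) ^ i ≠ 0)
    {s : ZMod m} (hs : s = 2 ∨ s = -2) :
    (Finset.univ.image (s ^ i * ·)).card =
      m / Nat.card (Subgroup.upperCentralSeries (DihedralGroup m) i) := by
  have h := card_upperCentralSeries_mul_card_image hi hs
  refine (Nat.div_eq_of_eq_mul_right (Nat.pos_of_ne_zero fun h0 => ?_) h.symm).symm
  rw [h0, zero_mul] at h
  exact NeZero.ne m h.symm

/-! ### The commutation semigroups as sets of affine maps -/

/-- The map sending `r i` to `r (A * i)` and `sr k` to `r (A * k + C)`. -/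
def affineMap {m : ℕ} (A C : ZMod m) : Function.End (DihedralGroup m)
  | .r i => .r (A * i)
  | .sr k => .r (A * k + C)

lemma affineMap_mul {m : ℕ} (A C A' C' : ZMod m) :
    affineMap A C * affineMap A' C' = affineMap (A * A') (A * C') := by
  funext x
  cases x <;> simp only [Function.End.mul_def, Function.comp, affineMap, r.injEq] <;> ring

lemma affineMap_injective {m : ℕ} :
    Function.Injective fun p : ZMod m × ZMod m => affineMap p.1 p.2 := by
  rintro ⟨A, C⟩ ⟨A', C'⟩ h
  have h1 := congrFun h (r 1)
  have h2 := congrFun h (sr 0)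
  simp only [affineMap, r.injEq, mul_one, mul_zero, zero_add] at h1 h2
  rw [h1, h2]

/-- The semigroup generated by the maps `affineMap 0 (2 * c)` and `affineMap s (s * c)`. -/
def affineSemigroup {m : ℕ} (s : ZMod m) : Subsemigroup (Function.End (DihedralGroup m)) :=
  Subsemigroup.closure {f | ∃ c, f = affineMap 0 (2 * c) ∨ f = affineMap s (s * c)}

lemma Psg_eq_affineSemigroup (m : ℕ) : Psg m = affineSemigroup (-2) := by
  unfold Psg affineSemigroup
  congr 1
  ext f
  constructor
  · rintro ⟨g, rfl⟩
    cases g with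
    | r j =>
      refine ⟨j, .inl ?_⟩
      funext x
      cases x <;> simp [rmap, affineMap, gcomm_r_r, gcomm_sr_r]
    | sr l =>
      refine ⟨-l, .inr ?_⟩
      funext x
      cases x <;> simp only [rmap, affineMap, gcomm_r_sr, gcomm_sr_sr, r.injEq] <;> ring
  · rintro ⟨c, rfl | rfl⟩
    · refine ⟨r c, ?_⟩
      funext x
      cases x <;> simp [rmap, affineMap, gcomm_r_r, gcomm_sr_r]
    · refine ⟨sr (-c), ?_⟩
      funext x
      cases x <;> simp only [rmap, affineMap, gcomm_r_sr, gcomm_sr_sr, r.injEq] <;> ring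

lemma Lsg_eq_affineSemigroup (m : ℕ) : Lsg m = affineSemigroup 2 := by
  unfold Lsg affineSemigroup
  congr 1
  ext f
  constructor
  · rintro ⟨g, rfl⟩
    cases g with
    | r j =>
      refine ⟨-j, .inl ?_⟩
      funext x
      cases x <;> simp [lmap, affineMap, gcomm_r_r, gcomm_r_sr]
    | sr l =>
      refine ⟨-l, .inr ?_⟩
      funext x
      cases x <;> simp only [lmap, affineMap, gcomm_sr_r, gcomm_sr_sr, r.injEq] <;> ring
  · rintro ⟨c, rfl | rfl⟩
    · refine ⟨r (-c), ?_⟩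
      funext x
      cases x <;> simp [lmap, affineMap, gcomm_r_r, gcomm_r_sr]
    · refine ⟨sr (-c), ?_⟩
      funext x
      cases x <;> simp only [lmap, affineMap, gcomm_sr_r, gcomm_sr_sr, r.injEq] <;> ring

lemma mem_affineSemigroup {m : ℕ} {s : ZMod m} {f : Function.End (DihedralGroup m)} :
    f ∈ affineSemigroup s ↔
      ∃ c, f = affineMap 0 (2 * c) ∨ ∃ k, 0 < k ∧ f = affineMap (s ^ k) (s ^ k * c) := by
  constructor
  · intro hf
    induction hf using Subsemigroup.closure_induction with
    | mem f hf =>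
      obtain ⟨c, rfl | rfl⟩ := hf
      · exact ⟨c, .inl rfl⟩
      · exact ⟨c, .inr ⟨1, one_pos, by rw [pow_one]⟩⟩
    | mul f g _ _ hf hg =>
      obtain ⟨c, rfl | ⟨k, hk, rfl⟩⟩ := hf <;> obtain ⟨d, rfl | ⟨l, hl, rfl⟩⟩ := hg <;>
        simp only [affineMap_mul]
      · exact ⟨0, .inl (by simp)⟩
      · exact ⟨0, .inl (by simp)⟩
      · exact ⟨s ^ k * d, .inl (by congr 1 <;> ring)⟩
      · exact ⟨d, .inr ⟨k + l, by omega, by congr 1 <;> ring⟩⟩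
  · rintro ⟨c, rfl | ⟨k, hk, rfl⟩⟩
    · exact Subsemigroup.subset_closure ⟨c, .inl rfl⟩
    · induction k, hk using Nat.le_induction with
      | base => exact Subsemigroup.subset_closure ⟨c, .inr (by simp)⟩
      | succ k hk ih =>
        have := mul_mem (Subsemigroup.subset_closure
          (show affineMap s (s * 0) ∈ {f | ∃ c, f = affineMap 0 (2 * c) ∨ f = affineMap s (s * c)}
            from ⟨0, .inr rfl⟩)) ih
        rw [affineMap_mul] at this
        rwa [← mul_assoc, ← pow_succ'] at this

/-- If `s ^ i`, for `i` in `T`, enumerates without repetition the nonzero positive powers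
of `s = ±2`, then the cardinality of `affineSemigroup s` is a sum over `T`. -/
lemma card_affineSemigroup {m : ℕ} [NeZero m] {s : ZMod m} (hs : s = 2 ∨ s = -2)
    (h2 : (2 : ZMod m) ≠ 0) (T : Finset ℕ) (hpos : ∀ i ∈ T, 0 < i) (h0 : ∀ i ∈ T, s ^ i ≠ 0)
    (hinj : Set.InjOn (s ^ ·) (T : Set ℕ))
    (hsurj : ∀ k, 0 < k → s ^ k ≠ 0 → ∃ i ∈ T, s ^ i = s ^ k) :
    Nat.card (affineSemigroup s) =
      m / Nat.card (Subgroup.upperCentralSeries (DihedralGroup m) 1) +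
        ∑ i ∈ T, m / Nat.card (Subgroup.upperCentralSeries (DihedralGroup m) i) := by
  classical
  let S : Finset (ZMod m × ZMod m) :=
    ({0} ×ˢ Finset.univ.image (2 ^ 1 * ·)) ∪
      T.biUnion fun i => {s ^ i} ×ˢ Finset.univ.image (s ^ i * ·)
  have hS : (affineSemigroup s : Set (Function.End (DihedralGroup m))) =
      (fun p : ZMod m × ZMod m => affineMap p.1 p.2) '' S := by
    ext f
    rw [SetLike.mem_coe, mem_affineSemigroup]
    simp only [S, Set.mem_image, Finset.mem_coe, Finset.mem_union, Finset.mem_biUnion,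
      Finset.mem_product, Finset.mem_singleton, Finset.mem_image, Finset.mem_univ, true_and,
      Prod.exists, pow_one]
    constructor
    · rintro ⟨c, rfl | ⟨k, hk, rfl⟩⟩
      · exact ⟨0, 2 * c, .inl ⟨rfl, c, rfl⟩, rfl⟩
      · by_cases hk0 : s ^ k = 0
        · exact ⟨0, 0, .inl ⟨rfl, 0, mul_zero _⟩, by simp [hk0]⟩
        · obtain ⟨i, hi, hik⟩ := hsurj k hk hk0
          exact ⟨s ^ k, s ^ k * c, .inr ⟨i, hi, hik.symm, c, by rw [hik]⟩, rfl⟩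
    · rintro ⟨A, C, ⟨rfl, c, rfl⟩ | ⟨i, hi, rfl, c, rfl⟩, rfl⟩
      · exact ⟨c, .inl rfl⟩
      · exact ⟨c, .inr ⟨i, hpos i hi, rfl⟩⟩
  have hcard : Nat.card (affineSemigroup s) = S.card := by
    rw [← SetLike.coe_sort_coe, Nat.card_coe_set_eq, hS,
      Set.ncard_image_of_injective _ affineMap_injective, Set.ncard_coe_finset]
  rw [hcard, Finset.card_union_of_disjoint, Finset.card_biUnion]
  · simp only [Finset.card_product, Finset.card_singleton, one_mul]
    rw [card_image_pow_mul (by simpa using h2) (.inl rfl)]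
    congr 1
    exact Finset.sum_congr rfl fun i hi => card_image_pow_mul
      (mt (pow_eq_zero_iff_two_pow hs i).2 (h0 i hi)) hs
  · intro i hi j hj hij
    rw [Function.onFun, Finset.disjoint_product, Finset.disjoint_singleton]
    exact .inl fun h => hij (hinj hi hj h)
  · rw [Finset.disjoint_biUnion_right]
    intro i hi
    rw [Finset.disjoint_product, Finset.disjoint_singleton]
    exact .inl (h0 i hi).symm

/-! ### Powers of an element with given index and period -/

lemma pow_add_mul_period {M : Type*} [Monoid M] {x : M} {c p : ℕ} (h : x ^ c = x ^ (c + p))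
    (N : ℕ) : x ^ (c + p * N) = x ^ c := by
  induction N with
  | zero => rfl
  | succ N ih => rw [mul_add, mul_one, ← add_assoc, pow_add, ih, ← pow_add, ← h]

lemma injOn_pow_Icc {M : Type*} [Monoid M] {x : M} {c p : ℕ} (hp : 0 < p)
    (h : x ^ c = x ^ (c + p)) (hpmin : ∀ k, 0 < k → x ^ c = x ^ (c + k) → p ≤ k)
    (hcmin : ∀ d k, 0 < d → 0 < k → x ^ d = x ^ (d + k) → c ≤ d) :
    Set.InjOn (x ^ ·) (Finset.Icc 1 (c + p - 1) : Set ℕ) := by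
  have key : ∀ i j, 1 ≤ i → j ≤ c + p - 1 → x ^ i = x ^ j → ¬ i < j := by
    intro i j hi hj hij hlt
    obtain ⟨k, rfl⟩ := Nat.exists_eq_add_of_lt hlt
    have hci := hcmin i (k + 1) hi k.succ_pos hij
    have hle : i ≤ c + p * i := (Nat.le_mul_of_pos_left i hp).trans (Nat.le_add_left _ _)
    obtain ⟨e, he⟩ := Nat.exists_eq_add_of_le hle
    have hk : x ^ c = x ^ (c + (k + 1)) := by
      calc x ^ c = x ^ i * x ^ e := by rw [← pow_add, ← he, pow_add_mul_period h]
        _ = x ^ (c + p * i) * x ^ (k + 1) := by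
          rw [hij, he, ← pow_add, ← pow_add]; congr 1; ring
        _ = x ^ (c + (k + 1)) := by rw [pow_add_mul_period h, ← pow_add]
    have := hpmin (k + 1) k.succ_pos hk
    omega
  intro i hi j hj hij
  simp only [Finset.coe_Icc, Set.mem_Icc] at hi hj
  exact le_antisymm (not_lt.1 (key j i hj.1 hi.2 hij.symm)) (not_lt.1 (key i j hi.1 hj.2 hij))

lemma exists_pow_eq_Icc {M : Type*} [Monoid M] {x : M} {c p : ℕ} (hc : 0 < c) (hp : 0 < p)
    (h : x ^ c = x ^ (c + p)) (k : ℕ) (hk : 0 < k) :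
    ∃ i ∈ Finset.Icc 1 (c + p - 1), x ^ i = x ^ k := by
  induction k using Nat.strong_induction_on with
  | _ k ih =>
    by_cases hkc : k ≤ c + p - 1
    · exact ⟨k, Finset.mem_Icc.2 ⟨hk, hkc⟩, rfl⟩
    · obtain ⟨e, rfl⟩ := Nat.exists_eq_add_of_le (show c + p ≤ k by omega)
      obtain ⟨i, hi, hie⟩ := ih (c + e) (by omega) (by omega)
      exact ⟨i, hi, by rw [hie, pow_add, h, ← pow_add]⟩

/-! ### Powers of `±2` modulo `m` -/

lemma two_pow_eq_zero_iff (m i : ℕ) : (2 : ZMod m) ^ i = 0 ↔ m ∣ 2 ^ i := by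
  rw [← ZMod.natCast_eq_zero_iff]
  push_cast
  rfl

lemma le_of_pow_eq_pow_add {ℓ n c k : ℕ} (hk : 0 < k) {s : ZMod (2 ^ ℓ * n)}
    (hs : s = 2 ∨ s = -2) (h : s ^ c = s ^ (c + k)) : ℓ ≤ c := by
  obtain ⟨σ, hσ, rfl⟩ : ∃ σ : ℤ, (σ = 2 ∨ σ = -2) ∧ s = (σ : ZMod (2 ^ ℓ * n)) := by
    rcases hs with rfl | rfl
    exacts [⟨2, .inl rfl, by simp⟩, ⟨-2, .inr rfl, by simp⟩]
  have hdvd : ((2 ^ ℓ * n : ℕ) : ℤ) ∣ σ ^ c * (σ ^ k - 1) := by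
    rw [← ZMod.intCast_zmod_eq_zero_iff_dvd]
    push_cast
    rw [mul_sub, ← pow_add, ← h]
    ring
  have heven : Even (σ ^ k) := by
    rw [Int.even_pow]
    exact ⟨by rcases hσ with rfl | rfl <;> decide, hk.ne'⟩
  have hcop : IsCoprime ((2 : ℤ) ^ ℓ) (σ ^ k - 1) := by
    refine IsCoprime.pow_left ?_
    obtain ⟨a, ha⟩ := heven
    exact ⟨a, -1, by rw [ha]; ring⟩
  have h2 : (2 : ℤ) ^ ℓ ∣ σ ^ c := by
    refine hcop.dvd_of_dvd_mul_right (Dvd.dvd.trans ?_ hdvd)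
    push_cast
    exact dvd_mul_right _ _
  have h3 : 2 ^ ℓ ∣ 2 ^ c := by
    have := Int.natAbs_dvd_natAbs.2 h2
    rw [Int.natAbs_pow, Int.natAbs_pow] at this
    rcases hσ with rfl | rfl <;> exact this
  exact (Nat.pow_dvd_pow_iff_le_right (by norm_num)).1 h3

lemma exists_pow_eq_pow_add {ℓ n : ℕ} (hn : Odd n) {s : ZMod (2 ^ ℓ * n)}
    (hs : s = 2 ∨ s = -2) : ∃ k, 0 < k ∧ s ^ ℓ = s ^ (ℓ + k) := by
  refine ⟨2 * n.totient, by have := Nat.totient_pos.2 hn.pos; omega, ?_⟩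
  have h4 : n ∣ 4 ^ n.totient - 1 :=
    (Nat.modEq_iff_dvd' (Nat.one_le_pow _ _ (by norm_num))).1
      (Nat.ModEq.pow_totient (show Nat.Coprime 4 n from
        Nat.Coprime.pow_left 2 (Nat.coprime_two_left.2 hn))).symm
  have h5 : ((2 ^ ℓ * (4 ^ n.totient - 1) : ℕ) : ZMod (2 ^ ℓ * n)) = 0 :=
    (ZMod.natCast_eq_zero_iff _ _).2 (mul_dvd_mul_left _ h4)
  rw [Nat.cast_mul, Nat.cast_sub (Nat.one_le_pow _ _ (by norm_num))] at h5
  push_cast at h5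
  have hs2 : s ^ 2 = 4 := by rcases hs with rfl | rfl <;> norm_num
  rw [pow_add, pow_mul, hs2, eq_comm, ← sub_eq_zero, ← mul_sub_one]
  rcases hs with rfl | rfl
  · exact h5
  · rw [neg_pow, mul_assoc, h5, mul_zero]

lemma ind_eq {ℓ n : ℕ} (hℓ : 0 < ℓ) (hn : Odd n) {s : ZMod (2 ^ ℓ * n)}
    (hs : s = 2 ∨ s = -2) : ind (2 ^ ℓ * n) s = ℓ := by
  have hmem : ℓ ∈ {c : ℕ | 0 < c ∧ ∃ k : ℕ, 0 < k ∧ s ^ c = s ^ (c + k)} :=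
    ⟨hℓ, exists_pow_eq_pow_add hn hs⟩
  refine le_antisymm (Nat.sInf_le hmem) ?_
  obtain ⟨-, k, hk, h⟩ := Nat.sInf_mem ⟨ℓ, hmem⟩
  exact le_of_pow_eq_pow_add hk hs h

/-- The exponents `1, …, t - 1` enumerate the nonzero positive powers of `±2` modulo
`2 ^ ℓ * n`. -/
lemma pow_enumeration {ℓ n t : ℕ} (hn : Odd n) {s : ZMod (2 ^ ℓ * n)}
    (hs : s = 2 ∨ s = -2)
    (ht : (ℓ = 0 ∧ 1 < n ∧ t = 1 + orderOf s) ∨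
          (0 < ℓ ∧ 1 < n ∧ t = ℓ + per (2 ^ ℓ * n) s) ∨
          (0 < ℓ ∧ n = 1 ∧ t = ℓ)) :
    (∀ i ∈ Finset.Icc 1 (t - 1), s ^ i ≠ 0) ∧
    Set.InjOn (s ^ ·) (Finset.Icc 1 (t - 1) : Set ℕ) ∧
    ∀ k, 0 < k → s ^ k ≠ 0 → ∃ i ∈ Finset.Icc 1 (t - 1), s ^ i = s ^ k := by
  have hne : 1 < n → ∀ i, s ^ i ≠ 0 := by
    intro h1 i h0
    rw [pow_eq_zero_iff_two_pow hs, two_pow_eq_zero_iff] at h0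
    have := (Nat.Coprime.pow_right i (Nat.coprime_two_right.2 hn)).eq_one_of_dvd
      ((dvd_mul_left _ _).trans h0)
    omega
  obtain ⟨k₀, hk₀, hk₀'⟩ := exists_pow_eq_pow_add hn hs
  rcases ht with ⟨rfl, h1, rfl⟩ | ⟨hℓ, h1, rfl⟩ | ⟨hℓ, rfl, rfl⟩
  · have hone : s ^ k₀ = 1 := by simpa using hk₀'.symm
    have hord : 0 < orderOf s := orderOf_pos_iff.2 (isOfFinOrder_iff_pow_eq_one.2 ⟨k₀, hk₀, hone⟩)
    have hper : s ^ 1 = s ^ (1 + orderOf s) := by rw [pow_add, pow_orderOf_eq_one, mul_one]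
    refine ⟨fun i _ => hne h1 i, injOn_pow_Icc hord hper (fun k hk hk' => ?_)
      (fun d _ hd _ _ => hd), fun k hk _ => exists_pow_eq_Icc one_pos hord hper k hk⟩
    have hu : IsUnit s := IsUnit.of_pow_eq_one hone hk₀.ne'
    refine orderOf_le_of_pow_eq_one hk (hu.mul_left_cancel ?_)
    rw [← pow_succ', mul_one, add_comm, ← hk', pow_one]
  · obtain ⟨hp, hper⟩ : 0 < per (2 ^ ℓ * n) s ∧ s ^ ℓ = s ^ (ℓ + per (2 ^ ℓ * n) s) := by
      have h := Nat.sInf_mem (s := {k | 0 < k ∧ s ^ ind _ s = s ^ (ind _ s + k)})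
        ⟨k₀, hk₀, by rwa [ind_eq hℓ hn hs]⟩
      change 0 < per _ s ∧ s ^ ind _ s = s ^ (ind _ s + per _ s) at h
      rwa [ind_eq hℓ hn hs] at h
    refine ⟨fun i _ => hne h1 i, injOn_pow_Icc hp hper (fun k hk hk' => ?_)
      (fun d k _ hk h => le_of_pow_eq_pow_add hk hs h),
      fun k hk _ => exists_pow_eq_Icc hℓ hp hper k hk⟩
    exact Nat.sInf_le ⟨hk, by rwa [ind_eq hℓ hn hs]⟩
  · have hz : ∀ i, s ^ i = 0 ↔ t ≤ i := by
      intro i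
      rw [pow_eq_zero_iff_two_pow hs, two_pow_eq_zero_iff, mul_one,
        Nat.pow_dvd_pow_iff_le_right (by norm_num)]
    refine ⟨fun i hi => ?_, ?_, fun k hk hk0 => ⟨k, ?_, rfl⟩⟩
    · rw [Finset.mem_Icc] at hi
      rw [Ne, hz]
      omega
    · have key : ∀ i j, j ≤ t - 1 → s ^ i = s ^ j → ¬ i < j := by
        intro i j hj hij hlt
        have h0 : s ^ (i + (t - j)) = 0 := by
          rw [pow_add, hij, ← pow_add, hz]
          omega
        rw [hz] at h0
        omega
      intro i hi j hj hij
      simp only [Finset.coe_Icc, Set.mem_Icc] at hi hj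
      exact le_antisymm (not_lt.1 (key j i hi.2 hij.symm)) (not_lt.1 (key i j hj.2 hij))
    · rw [Ne, hz] at hk0
      rw [Finset.mem_Icc]
      omega

/-- Theorem 21 (Main Theorem): for `m = 2^ℓ·n > 3` with `n` odd,
`|P(D_m)| = m/|Z_1| + Σ_{i=1}^{t-1} m/|Z_i|` and
`|Λ(D_m)| = m/|Z_1| + Σ_{i=1}^{t'-1} m/|Z_i|`, where `Z_i` is the `i`-th term of the
upper central series of `D_m`, each `|Z_i|` occurring divides `m`, and `t, t'` are as
given by the case distinctions. -/
theorem stmt_17 (ℓ n m t t' : ℕ) (hm : m = 2 ^ ℓ * n) (hm3 : 3 < m) (hn : Odd n)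
    (ht : (ℓ = 0 ∧ 1 < n ∧ t = 1 + orderOf (-2 : ZMod m)) ∨
          (0 < ℓ ∧ 1 < n ∧ t = ℓ + per m (-2)) ∨
          (0 < ℓ ∧ n = 1 ∧ t = ℓ))
    (ht' : (ℓ = 0 ∧ 1 < n ∧ t' = 1 + orderOf (2 : ZMod m)) ∨
           (0 < ℓ ∧ 1 < n ∧ t' = ℓ + per m 2) ∨
           (0 < ℓ ∧ n = 1 ∧ t' = ℓ)) :
    (Nat.card ↥(upperCentralSeries (DihedralGroup m) 1) ∣ m) ∧
    (∀ i ∈ Finset.Icc 1 (max t t' - 1),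
      Nat.card ↥(upperCentralSeries (DihedralGroup m) i) ∣ m) ∧
    Nat.card ↥(Psg m) =
      m / Nat.card ↥(upperCentralSeries (DihedralGroup m) 1) +
        ∑ i ∈ Finset.Icc 1 (t - 1),
          m / Nat.card ↥(upperCentralSeries (DihedralGroup m) i) ∧
    Nat.card ↥(Lsg m) =
      m / Nat.card ↥(upperCentralSeries (DihedralGroup m) 1) +
        ∑ i ∈ Finset.Icc 1 (t' - 1),
          m / Nat.card ↥(upperCentralSeries (DihedralGroup m) i) := by
  subst hm
  have : NeZero (2 ^ ℓ * n) := ⟨by omega⟩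
  have h2 : (2 : ZMod (2 ^ ℓ * n)) ≠ 0 := by
    intro h
    have := Nat.le_of_dvd two_pos ((two_pow_eq_zero_iff (2 ^ ℓ * n) 1).1 (by rwa [pow_one]))
    omega
  obtain ⟨hP0, hPinj, hPsurj⟩ := pow_enumeration hn (.inr rfl) ht
  obtain ⟨hL0, hLinj, hLsurj⟩ := pow_enumeration hn (.inl rfl) ht'
  have hP2 : ∀ i ∈ Finset.Icc 1 (t - 1), (2 : ZMod (2 ^ ℓ * n)) ^ i ≠ 0 := fun i hi =>
    mt (pow_eq_zero_iff_two_pow (.inr rfl) i).2 (hP0 i hi)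
  refine ⟨card_upperCentralSeries_dvd (by rwa [pow_one]), fun i hi =>
    card_upperCentralSeries_dvd ?_, ?_, ?_⟩
  · rw [Finset.mem_Icc] at hi
    rcases le_total t t' with h | h
    · exact hL0 i (Finset.mem_Icc.2 (by rwa [max_eq_right h] at hi))
    · exact hP2 i (Finset.mem_Icc.2 (by rwa [max_eq_left h] at hi))
  · rw [Psg_eq_affineSemigroup]
    exact card_affineSemigroup (.inr rfl) h2 _ (fun i hi => (Finset.mem_Icc.1 hi).1)
      hP0 hPinj hPsurj
  · rw [Lsg_eq_affineSemigroup]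
    exact card_affineSemigroup (.inl rfl) h2 _ (fun i hi => (Finset.mem_Icc.1 hi).1)
      hL0 hLinj hLsurj
end
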